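/- Under the two-group random mixture model, let W_(1)≤W_(2)≤…≤W_(n) be the order statistics of W1,…,Wn. Then FNR*_n(α) equals the infimum, over all Markov kernels P_{K|X^n} from 𝒳^n to {0,1,…,n}, of E[(1/(n−K))Σ_{i=K+1}^n (1−W_(i))] subject to E[(1/K)Σ_{i=1}^K W_(i)] ≤ α (with the conventions that (1/K)Σ_{i=1}^K W_(i)=0 if K=0 and (1/(n−K))Σ_{i=K+1}^n (1−W_(i))=0 if K=n). Furthermore, this infimum is unchanged when restricting to kernels such that, conditionally on X^n=x^n, K takes at most two values. -/

import Mathlib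

open MeasureTheory ProbabilityTheory Filter

namespace TwoGroup

/-- The two-group random mixture model: a σ-finite base measure on the sample space `𝒳`,
a null proportion `π0 ∈ (0,1)`, and null/non-null probability density functions `f0`, `f1`
with respect to the base measure. -/
structure Model (𝒳 : Type*) [MeasurableSpace 𝒳] where
  base : Measure 𝒳
  sigmaFinite : SigmaFinite base
  π0 : ℝ
  π0_mem : π0 ∈ Set.Ioo (0 : ℝ) 1
  f0 : 𝒳 → ℝ
  f1 : 𝒳 → ℝ
  f0_meas : Measurable f0
  f1_meas : Measurable f1
  f0_nonneg : ∀ x, 0 ≤ f0 x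
  f1_nonneg : ∀ x, 0 ≤ f1 x
  f0_prob : IsProbabilityMeasure (base.withDensity fun x => ENNReal.ofReal (f0 x))
  f1_prob : IsProbabilityMeasure (base.withDensity fun x => ENNReal.ofReal (f1 x))

namespace Model

variable {𝒳 : Type*} [MeasurableSpace 𝒳] (M : Model 𝒳)

/-- The non-null proportion `π1 = 1 - π0`. -/
noncomputable def π1 : ℝ := 1 - M.π0

/-- The marginal density `f = π0 f0 + π1 f1`. -/
noncomputable def f (x : 𝒳) : ℝ := M.π0 * M.f0 x + M.π1 * M.f1 x

/-- The local false discovery rate `Lfdr(x) = π0 f0(x) / f(x)`. -/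
noncomputable def Lfdr (x : 𝒳) : ℝ := M.π0 * M.f0 x / M.f x

/-- The joint law of a single pair `(θ, X)`; `true` encodes `θ = 1` (non-null). -/
noncomputable def joint : Measure (Bool × 𝒳) :=
  (ENNReal.ofReal M.π0) •
      ((Measure.dirac false).prod (M.base.withDensity fun x => ENNReal.ofReal (M.f0 x))) +
    (ENNReal.ofReal M.π1) •
      ((Measure.dirac true).prod (M.base.withDensity fun x => ENNReal.ofReal (M.f1 x)))

/-- The joint law of `((θ1, X1), …, (θn, Xn))`: i.i.d. copies of `(θ, X)`. -/
noncomputable def jointN (n : ℕ) : Measure (Fin n → Bool × 𝒳) :=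
  Measure.pi fun _ => M.joint

end Model

/-- Number of rejections `Σ_i δ_i`. -/
def nRej {n : ℕ} (d : Fin n → Bool) : ℝ := ∑ i, if d i then (1 : ℝ) else 0

/-- Number of false discoveries `Σ_i δ_i (1 - θ_i)`. -/
def nFD {n : ℕ} (θ d : Fin n → Bool) : ℝ :=
  ∑ i, (if d i then (1 : ℝ) else 0) * (if θ i then (0 : ℝ) else 1)

/-- Number of acceptances `Σ_i (1 - δ_i)`. -/
def nAcc {n : ℕ} (d : Fin n → Bool) : ℝ := ∑ i, if d i then (0 : ℝ) else 1

/-- Number of false non-discoveries `Σ_i (1 - δ_i) θ_i`. -/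
def nFN {n : ℕ} (θ d : Fin n → Bool) : ℝ :=
  ∑ i, (if d i then (0 : ℝ) else 1) * (if θ i then (1 : ℝ) else 0)

/-- False discovery proportion. -/
noncomputable def FDP {n : ℕ} (θ d : Fin n → Bool) : ℝ := nFD θ d / max 1 (nRej d)

/-- False non-discovery proportion. -/
noncomputable def FNP {n : ℕ} (θ d : Fin n → Bool) : ℝ := nFN θ d / max 1 (nAcc d)

/-- A decision rule is a Markov kernel from `𝒳^n` to `{0,1}^n`: a measurable family of
probability measures on `Fin n → Bool`. -/
def IsRule {𝒳 : Type*} [MeasurableSpace 𝒳] {n : ℕ}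
    (κ : (Fin n → 𝒳) → Measure (Fin n → Bool)) : Prop :=
  Measurable κ ∧ ∀ x, IsProbabilityMeasure (κ x)

namespace Model

variable {𝒳 : Type*} [MeasurableSpace 𝒳] (M : Model 𝒳)

/-- The false discovery rate `FDR = E[FDP]` of a (randomized) decision rule. -/
noncomputable def FDR (n : ℕ) (κ : (Fin n → 𝒳) → Measure (Fin n → Bool)) : ℝ :=
  ∫ ω, ∫ d, FDP (fun i => (ω i).1) d ∂(κ fun i => (ω i).2) ∂(M.jointN n)

/-- The false non-discovery rate `FNR = E[FNP]` of a (randomized) decision rule. -/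
noncomputable def FNR (n : ℕ) (κ : (Fin n → 𝒳) → Measure (Fin n → Bool)) : ℝ :=
  ∫ ω, ∫ d, FNP (fun i => (ω i).1) d ∂(κ fun i => (ω i).2) ∂(M.jointN n)

/-- The marginal FDR `mFDR = E[Σ δi (1-θi)] / E[Σ δi]` (with `0/0 = 0`). -/
noncomputable def mFDR (n : ℕ) (κ : (Fin n → 𝒳) → Measure (Fin n → Bool)) : ℝ :=
  (∫ ω, ∫ d, nFD (fun i => (ω i).1) d ∂(κ fun i => (ω i).2) ∂(M.jointN n)) /
    (∫ ω, ∫ d, nRej d ∂(κ fun i => (ω i).2) ∂(M.jointN n))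

/-- The marginal FNR `mFNR = E[Σ (1-δi) θi] / E[Σ (1-δi)]` (with `0/0 = 0`). -/
noncomputable def mFNR (n : ℕ) (κ : (Fin n → 𝒳) → Measure (Fin n → Bool)) : ℝ :=
  (∫ ω, ∫ d, nFN (fun i => (ω i).1) d ∂(κ fun i => (ω i).2) ∂(M.jointN n)) /
    (∫ ω, ∫ d, nAcc d ∂(κ fun i => (ω i).2) ∂(M.jointN n))

/-- `FNR*_n(α)`: the minimum FNR over decision rules controlling FDR at level `α`. -/
noncomputable def FNRstar (n : ℕ) (α : ℝ) : ℝ :=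
  sInf {r | ∃ κ : (Fin n → 𝒳) → Measure (Fin n → Bool),
    IsRule κ ∧ M.FDR n κ ≤ α ∧ r = M.FNR n κ}

/-- The minimum mFNR over decision rules for `n` hypotheses controlling mFDR at level `α`. -/
noncomputable def mFNRstarN (n : ℕ) (α : ℝ) : ℝ :=
  sInf {r | ∃ κ : (Fin n → 𝒳) → Measure (Fin n → Bool),
    IsRule κ ∧ M.mFDR n κ ≤ α ∧ r = M.mFNR n κ}

/-- `mFNR*(α)` (this quantity does not depend on the number of hypotheses; we take `n = 1`). -/
noncomputable def mFNRstar (α : ℝ) : ℝ := M.mFNRstarN 1 α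

/-- The marginal law of a single observation `X ∼ f`. -/
noncomputable def Pmix : Measure 𝒳 := M.base.withDensity fun x => ENNReal.ofReal (M.f x)

/-- The law of `W = Lfdr(X)`, `X ∼ f`. -/
noncomputable def νW : Measure ℝ := M.Pmix.map M.Lfdr

/-- `G(t) = P(W ≤ t)`. -/
noncomputable def G (t : ℝ) : ℝ := (M.νW (Set.Iic t)).toReal

/-- `Ḡ(t) = P(W < t)`. -/
noncomputable def Gbar (t : ℝ) : ℝ := (M.νW (Set.Iio t)).toReal

/-- The generalized inverse `G^{-1}(u) = inf{t : G(t) ≥ u}`. -/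
noncomputable def Ginv (u : ℝ) : ℝ := sInf {t | u ≤ M.G t}

/-- `P(W = t)`. -/
noncomputable def atom (t : ℝ) : ℝ := (M.νW {t}).toReal

/-- The randomization probability `p(u)`, satisfying
`Ḡ(G^{-1}(u)) + p(u) P(W = G^{-1}(u)) = u`. -/
noncomputable def pu (u : ℝ) : ℝ := (u - M.Gbar (M.Ginv u)) / M.atom (M.Ginv u)

/-- `a(u) = E[W | S_u = 1]` for `u ∈ (0,1]`, `a(0) = 0`, where `S_u` is the Bernoulli(u)
thresholding variable of `W` at `G^{-1}(u)` with randomization `p(u)` at the boundary. -/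
noncomputable def a (u : ℝ) : ℝ :=
  if u = 0 then 0
  else ((∫ w in Set.Iio (M.Ginv u), w ∂M.νW) + M.pu u * (M.Ginv u * M.atom (M.Ginv u))) / u

/-- `b(u) = E[1 - W | S_u = 0]` for `u ∈ [0,1)`, `b(1) = 0`. -/
noncomputable def b (u : ℝ) : ℝ :=
  if u = 1 then 0
  else ((∫ w in Set.Ioi (M.Ginv u), (1 - w) ∂M.νW)
      + (1 - M.pu u) * ((1 - M.Ginv u) * M.atom (M.Ginv u))) / (1 - u)

/-- `b*(α) = inf{b(u) : u ∈ [0,1], a(u) ≤ α}`. -/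
noncomputable def bstar (α : ℝ) : ℝ :=
  sInf {y | ∃ u ∈ Set.Icc (0 : ℝ) 1, M.a u ≤ α ∧ y = M.b u}

/-- `u*(α) = sup{u ∈ [0,1] : a(u) ≤ α}`. -/
noncomputable def ustar (α : ℝ) : ℝ :=
  sSup {u | u ∈ Set.Icc (0 : ℝ) 1 ∧ M.a u ≤ α}

/-- `b**(α) = inf{E[b(U)] : U a [0,1]-valued random variable with E[a(U)] ≤ α}`. -/
noncomputable def bstarstar (α : ℝ) : ℝ :=
  sInf {y | ∃ ρ : Measure ℝ, IsProbabilityMeasure ρ ∧ (∀ᵐ u ∂ρ, u ∈ Set.Icc (0 : ℝ) 1) ∧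
    (∫ u, M.a u ∂ρ) ≤ α ∧ y = ∫ u, M.b u ∂ρ}

end Model

/-- The Bernoulli(p) measure on `Bool`. -/
noncomputable def bern (p : ℝ) : Measure Bool :=
  (ENNReal.ofReal p) • Measure.dirac true + (ENNReal.ofReal (1 - p)) • Measure.dirac false

namespace Model

variable {𝒳 : Type*} [MeasurableSpace 𝒳] (M : Model 𝒳)

/-- The per-observation rejection probability of the Neyman–Pearson rule at level `α`:
reject if `Lfdr(x) < G^{-1}(u*(α))`, randomize with probability `p(u*(α))` at equality,
and accept otherwise. -/
noncomputable def qNP (α : ℝ) (x : 𝒳) : ℝ :=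
  if M.Lfdr x < M.Ginv (M.ustar α) then 1
  else if M.Lfdr x = M.Ginv (M.ustar α) then M.pu (M.ustar α)
  else 0

/-- The Neyman–Pearson rule `δ^n_NP(α)`, as a Markov kernel: independent randomized
likelihood-ratio tests applied to each observation. -/
noncomputable def NP (α : ℝ) (n : ℕ) : (Fin n → 𝒳) → Measure (Fin n → Bool) :=
  fun x => Measure.pi fun i => bern (M.qNP α (x i))

/-- The probability (over data and the randomization of the rule `κ`) that the decision vector
lies in the set `E θ` (which may depend on the true labels `θ`). -/
noncomputable def prob (n : ℕ) (κ : (Fin n → 𝒳) → Measure (Fin n → Bool))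
    (E : (Fin n → Bool) → Set (Fin n → Bool)) : ℝ :=
  (∫⁻ ω, κ (fun i => (ω i).2) (E fun i => (ω i).1) ∂(M.jointN n)).toReal

end Model

/-- `sortedVal n w i` is the `i`-th order statistic `w_(i)` (for `1 ≤ i ≤ n`) of
`w 0, …, w (n-1)`. -/
noncomputable def sortedVal (n : ℕ) (w : Fin n → ℝ) (i : ℕ) : ℝ :=
  ((Multiset.map w Finset.univ.val).sort (· ≤ ·)).getD (i - 1) 0

/-- `avgLow n w k = (1/k) Σ_{i=1}^k w_(i)` (equal to `0` when `k = 0`). -/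
noncomputable def avgLow (n : ℕ) (w : Fin n → ℝ) (k : ℕ) : ℝ :=
  (∑ i ∈ Finset.Icc 1 k, sortedVal n w i) / k

/-- `avgHigh n w k = (1/(n-k)) Σ_{i=k+1}^n (1 - w_(i))` (equal to `0` when `k = n`). -/
noncomputable def avgHigh (n : ℕ) (w : Fin n → ℝ) (k : ℕ) : ℝ :=
  (∑ i ∈ Finset.Icc (k + 1) n, (1 - sortedVal n w i)) / ((n : ℝ) - k)

/-- The greatest convex minorant on `[0,1]` of a function `h`, evaluated at `α`. -/
noncomputable def gcm (h : ℝ → ℝ) (α : ℝ) : ℝ :=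
  sSup {y | ∃ C : ℝ → ℝ, ConvexOn ℝ (Set.Icc 0 1) C ∧
    (∀ t ∈ Set.Icc (0 : ℝ) 1, C t ≤ h t) ∧ y = C α}

end TwoGroup

namespace TwoGroup

section Deterministic

variable {n : ℕ}

/-- The number of rejections, as a natural number. -/
def rejCount (d : Fin n → Bool) : ℕ := (Finset.univ.filter fun i => d i = true).card

/-- The average of `w` over the rejected coordinates (`0` if there are none). -/
noncomputable def lowLoss (w : Fin n → ℝ) (d : Fin n → Bool) : ℝ :=
  (∑ i, if d i then w i else 0) / max 1 (nRej d)

/-- The average of `1 - w` over the accepted coordinates (`0` if there are none). -/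
noncomputable def highLoss (w : Fin n → ℝ) (d : Fin n → Bool) : ℝ :=
  (∑ i, if d i then 0 else 1 - w i) / max 1 (nAcc d)

/-- The rule rejecting the `k` coordinates with the smallest values of `w`. -/
noncomputable def rankRule (w : Fin n → ℝ) (k : ℕ) : Fin n → Bool :=
  fun i => decide (((Tuple.sort w).symm i : ℕ) < k)

lemma nRej_eq_rejCount (d : Fin n → Bool) : nRej d = rejCount d := by
  simp [nRej, rejCount]

lemma nAcc_eq (d : Fin n → Bool) : nAcc d = n - nRej d := by
  have h : nAcc d + nRej d = n := by
    rw [nAcc, nRej, ← Finset.sum_add_distrib]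
    trans ∑ _i : Fin n, (1 : ℝ)
    · exact Finset.sum_congr rfl fun i _ => by cases d i <;> simp
    · simp
  linarith

lemma rejCount_le (d : Fin n → Bool) : rejCount d ≤ n := by
  simpa [rejCount] using Finset.card_le_univ (Finset.univ.filter fun i => d i = true)

lemma rejCount_rankRule (w : Fin n → ℝ) {k : ℕ} (hk : k ≤ n) :
    rejCount (rankRule w k) = k := by
  have h : (Finset.univ.filter fun i => rankRule w k i = true)
      = (Finset.univ.filter fun j : Fin n => (j : ℕ) < k).map (Tuple.sort w).toEmbedding := by
    ext i
    simp [rankRule]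
  rw [rejCount, h, Finset.card_map, Fin.card_filter_val_lt]
  exact min_eq_right hk

lemma lowLoss_mem {w : Fin n → ℝ} (hw : ∀ i, w i ∈ Set.Icc (0 : ℝ) 1) (d : Fin n → Bool) :
    lowLoss w d ∈ Set.Icc (0 : ℝ) 1 := by
  refine ⟨div_nonneg (Finset.sum_nonneg fun i _ => ?_) (by positivity),
    div_le_one_of_le₀ (le_max_of_le_right (Finset.sum_le_sum fun i _ => ?_)) (by positivity)⟩
  · split_ifs
    exacts [(hw i).1, le_rfl]
  · split_ifs
    exacts [(hw i).2, le_rfl]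

lemma highLoss_mem {w : Fin n → ℝ} (hw : ∀ i, w i ∈ Set.Icc (0 : ℝ) 1) (d : Fin n → Bool) :
    highLoss w d ∈ Set.Icc (0 : ℝ) 1 := by
  refine ⟨div_nonneg (Finset.sum_nonneg fun i _ => ?_) (by positivity),
    div_le_one_of_le₀ (le_max_of_le_right (Finset.sum_le_sum fun i _ => ?_)) (by positivity)⟩
  · split_ifs
    exacts [le_rfl, sub_nonneg.2 (hw i).2]
  · split_ifs
    exacts [le_rfl, by linarith [(hw i).1]]

lemma sortedVal_eq (w : Fin n → ℝ) (i : ℕ) :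
    sortedVal n w i = if h : i - 1 < n then w (Tuple.sort w ⟨i - 1, h⟩) else 0 := by
  have h : (Multiset.map w Finset.univ.val).sort (· ≤ ·)
      = List.ofFn (w ∘ Tuple.sort w) := by
    have h1 : Multiset.map w Finset.univ.val = (List.ofFn (w ∘ Tuple.sort w) : Multiset ℝ) := by
      have h2 : Multiset.map (Tuple.sort w) (Finset.univ : Finset (Fin n)).val
          = Finset.univ.val := by
        simp
      rw [← h2, Multiset.map_map, List.ofFn_eq_map]
      rfl
    rw [h1, Multiset.coe_sort]
    apply List.mergeSort_of_pairwise
    simp_rw [decide_eq_true_eq, ← List.sortedLE_iff_pairwise]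
    exact (Tuple.monotone_sort w).sortedLE_ofFn
  rw [sortedVal, h]
  split_ifs with hi
  · rw [List.getD_eq_getElem _ _ (by simpa using hi)]
    simp
  · rw [List.getD_eq_default _ _ (by simpa using hi)]

lemma sum_sorted_comp (w : Fin n → ℝ) (g : ℕ → ℝ → ℝ) :
    ∑ i ∈ Finset.Icc 1 n, g i (sortedVal n w i)
      = ∑ i : Fin n, g (((Tuple.sort w).symm i : ℕ) + 1) (w i) := by
  have h : Finset.Icc 1 n = (Finset.range n).image (· + 1) := by
    ext i
    simp only [Finset.mem_Icc, Finset.mem_image, Finset.mem_range]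
    exact ⟨fun hi => ⟨i - 1, by omega, by omega⟩, by rintro ⟨j, hj, rfl⟩; omega⟩
  rw [h, Finset.sum_image (by simp), Finset.sum_range,
    ← Equiv.sum_comp (Tuple.sort w) fun i => g (((Tuple.sort w).symm i : ℕ) + 1) (w i)]
  exact Finset.sum_congr rfl fun i _ => by simp [sortedVal_eq]

lemma avgLow_eq_lowLoss (w : Fin n → ℝ) {k : ℕ} (hk : k ≤ n) :
    avgLow n w k = lowLoss w (rankRule w k) := by
  have h : ∑ i ∈ Finset.Icc 1 k, sortedVal n w i
      = ∑ i, if rankRule w k i then w i else 0 := by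
    have h1 : Finset.Icc 1 k = (Finset.Icc 1 n).filter (· ≤ k) := by
      ext i
      simp only [Finset.mem_Icc, Finset.mem_filter]
      omega
    rw [h1, Finset.sum_filter, sum_sorted_comp w fun i v => if i ≤ k then v else 0]
    exact Finset.sum_congr rfl fun i _ => by simp [rankRule]
  rw [avgLow, lowLoss, h, nRej_eq_rejCount, rejCount_rankRule w hk]
  rcases Nat.eq_zero_or_pos k with rfl | hk0
  · simp [rankRule]
  · rw [max_eq_right (by exact_mod_cast hk0)]

lemma avgHigh_eq_highLoss (w : Fin n → ℝ) {k : ℕ} (hk : k ≤ n) :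
    avgHigh n w k = highLoss w (rankRule w k) := by
  have h : ∑ i ∈ Finset.Icc (k + 1) n, (1 - sortedVal n w i)
      = ∑ i, if rankRule w k i then 0 else 1 - w i := by
    have h1 : Finset.Icc (k + 1) n = (Finset.Icc 1 n).filter (¬ · ≤ k) := by
      ext i
      simp only [Finset.mem_Icc, Finset.mem_filter]
      omega
    rw [h1, Finset.sum_filter, sum_sorted_comp w fun i v => if ¬ i ≤ k then 1 - v else 0]
    exact Finset.sum_congr rfl fun i _ => by
      simp only [rankRule, decide_eq_true_eq, Nat.succ_le_iff, ite_not]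
  rw [avgHigh, highLoss, h, nAcc_eq, nRej_eq_rejCount, rejCount_rankRule w hk]
  rcases hk.eq_or_lt with rfl | hkn
  · simp [rankRule]
  · have : (k : ℝ) + 1 ≤ n := by exact_mod_cast hkn
    rw [max_eq_right (by linarith)]

lemma sum_rankRule_le (hn : 0 < n) (w : Fin n → ℝ) (d : Fin n → Bool) :
    ∑ i, (if rankRule w (rejCount d) i then w i else 0) ≤ ∑ i, if d i then w i else 0 := by
  set k := rejCount d with hk
  have hkn : k ≤ n := rejCount_le d
  set σ := Tuple.sort w
  set c := w (σ ⟨k - 1, by omega⟩)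
  have hcard : ∑ i, (if rankRule w k i then c else 0) = ∑ i, if d i then c else 0 := by
    rw [← Finset.sum_filter, ← Finset.sum_filter, Finset.sum_const, Finset.sum_const]
    exact congrArg (· • c) (rejCount_rankRule w hkn)
  have hmono : Monotone (w ∘ σ) := Tuple.monotone_sort w
  have hterm : ∀ i, (if rankRule w k i then w i else 0) - (if rankRule w k i then c else 0)
      ≤ (if d i then w i else 0) - if d i then c else 0 := by
    intro i
    by_cases hi : ((σ.symm i : Fin n) : ℕ) < k
    · have h1 : w i ≤ c := by
        have := hmono (show σ.symm i ≤ ⟨k - 1, by omega⟩ from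
          Fin.le_def.2 (Nat.le_sub_one_of_lt hi))
        simpa using this
      have h2 : rankRule w k i = true := by simpa [rankRule] using hi
      rw [h2]
      cases d i <;> simp [h1]
    · have h1 : c ≤ w i := by
        have := hmono (show ⟨k - 1, by omega⟩ ≤ σ.symm i from
          Fin.le_def.2 ((Nat.sub_le k 1).trans (not_lt.1 hi)))
        simpa using this
      have h2 : rankRule w k i = false := by simpa [rankRule] using hi
      rw [h2]
      cases d i <;> simp [h1]
  have := Finset.sum_le_sum fun i (_ : i ∈ Finset.univ) => hterm i
  rw [Finset.sum_sub_distrib, Finset.sum_sub_distrib, hcard] at this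
  linarith

lemma avgLow_rejCount_le (hn : 0 < n) (w : Fin n → ℝ) (d : Fin n → Bool) :
    avgLow n w (rejCount d) ≤ lowLoss w d := by
  rw [avgLow_eq_lowLoss w (rejCount_le d), lowLoss, lowLoss, nRej_eq_rejCount,
    rejCount_rankRule w (rejCount_le d), nRej_eq_rejCount]
  exact div_le_div_of_nonneg_right (by linarith [sum_rankRule_le hn w d]) (by positivity)

lemma sum_not_rejected (w : Fin n → ℝ) (d : Fin n → Bool) :
    ∑ i, (if d i then 0 else 1 - w i)
      = (n - rejCount d) - ∑ i, w i + ∑ i, if d i then w i else 0 := by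
  rw [← nRej_eq_rejCount, ← nAcc_eq, nAcc, ← Finset.sum_sub_distrib, ← Finset.sum_add_distrib]
  exact Finset.sum_congr rfl fun i _ => by cases d i <;> simp

lemma avgHigh_rejCount_le (hn : 0 < n) (w : Fin n → ℝ) (d : Fin n → Bool) :
    avgHigh n w (rejCount d) ≤ highLoss w d := by
  rw [avgHigh_eq_highLoss w (rejCount_le d), highLoss, highLoss, nAcc_eq, nAcc_eq,
    nRej_eq_rejCount, nRej_eq_rejCount, rejCount_rankRule w (rejCount_le d),
    sum_not_rejected, sum_not_rejected, rejCount_rankRule w (rejCount_le d)]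
  exact div_le_div_of_nonneg_right (by linarith [sum_rankRule_le hn w d]) (by positivity)

/-- A finitely supported planar distribution is dominated, in both coordinates, by one
supported on at most two of its atoms. -/
lemma exists_two_point_le (s : Finset ℕ) (q a b : ℕ → ℝ) (hq : ∀ k ∈ s, 0 ≤ q k)
    (hsum : ∑ k ∈ s, q k = 1) {A B : ℝ} (hA : A = ∑ k ∈ s, q k * a k)
    (hB : B = ∑ k ∈ s, q k * b k) :
    ∃ i ∈ s, ∃ j ∈ s, 0 ≤ (a j - A) / (a j - a i) ∧ (a j - A) / (a j - a i) ≤ 1 ∧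
      (a j - A) / (a j - a i) * a i + (1 - (a j - A) / (a j - a i)) * a j ≤ A ∧
      (a j - A) / (a j - a i) * b i + (1 - (a j - A) / (a j - a i)) * b j ≤ B := by
  by_contra! hcon
  set I := s.filter (a · ≤ A)
  set J := s.filter (¬ a · ≤ A)
  have hIJ : ∀ g : ℕ → ℝ, ∑ k ∈ I, g k + ∑ k ∈ J, g k = ∑ k ∈ s, g k := fun g =>
    Finset.sum_filter_add_sum_filter_not s _ g
  have hI : ∀ i ∈ I, i ∈ s ∧ a i ≤ A := fun i hi => Finset.mem_filter.1 hi
  have hJ : ∀ j ∈ J, j ∈ s ∧ A < a j := fun j hj => by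
    simpa [J] using hj
  have hSa : ∑ i ∈ I, q i * (A - a i) = ∑ j ∈ J, q j * (a j - A) := by
    have h := hIJ fun k => q k * (A - a k)
    have h0 : ∑ k ∈ s, q k * (A - a k) = 0 := by
      simp_rw [mul_sub, Finset.sum_sub_distrib, ← Finset.sum_mul, hsum]
      simp [hA]
    have h1 : ∑ j ∈ J, q j * (a j - A) = - ∑ j ∈ J, q j * (A - a j) := by
      rw [← Finset.sum_neg_distrib]
      exact Finset.sum_congr rfl fun _ _ => by ring
    linarith
  have hSb : ∑ i ∈ I, q i * (b i - B) + ∑ j ∈ J, q j * (b j - B) = 0 := by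
    rw [hIJ fun k => q k * (b k - B)]
    simp_rw [mul_sub, Finset.sum_sub_distrib, ← Finset.sum_mul, hsum]
    simp [hB]
  have hbI : ∀ i ∈ I, B < b i := fun i hi => by
    have := hcon i (hI i hi).1 i (hI i hi).1
    simp at this
    exact this (hI i hi).2
  have hpair : ∀ i ∈ I, ∀ j ∈ J, 0 < (a j - A) * (b i - B) + (A - a i) * (b j - B) := by
    intro i hi j hj
    have h1 := (hI i hi).2
    have h2 := (hJ j hj).2
    have hd : 0 < a j - a i := by linarith
    have h := hcon i (hI i hi).1 j (hJ j hj).1 (div_nonneg (by linarith) hd.le)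
      ((div_le_one hd).2 (by linarith)) (le_of_eq (by field_simp; ring))
    have h3 : (a j - A) * (b i - B) + (A - a i) * (b j - B)
        = (a j - a i) * ((a j - A) / (a j - a i) * b i + (1 - (a j - A) / (a j - a i)) * b j - B)
        := by
      field_simp
      ring
    rw [h3]
    exact mul_pos hd (by linarith)
  have hqI : ∀ i ∈ I, 0 ≤ q i := fun i hi => hq i (hI i hi).1
  have hqJ : ∀ j ∈ J, 0 ≤ q j := fun j hj => hq j (hJ j hj).1
  have hdouble : ∑ i ∈ I, ∑ j ∈ J,
      q i * q j * ((a j - A) * (b i - B) + (A - a i) * (b j - B)) = 0 := by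
    have h : ∀ i ∈ I, ∑ j ∈ J, q i * q j * ((a j - A) * (b i - B) + (A - a i) * (b j - B))
        = q i * (b i - B) * ∑ j ∈ J, q j * (a j - A)
          + q i * (A - a i) * ∑ j ∈ J, q j * (b j - B) := fun i _ => by
      rw [Finset.mul_sum, Finset.mul_sum, ← Finset.sum_add_distrib]
      exact Finset.sum_congr rfl fun j _ => by ring
    rw [Finset.sum_congr rfl h, Finset.sum_add_distrib, ← Finset.sum_mul, ← Finset.sum_mul, hSa,
      mul_comm, ← mul_add, hSb, mul_zero]
  have hzero : ∀ i ∈ I, ∀ j ∈ J, q i * q j = 0 := by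
    intro i hi j hj
    have hnn : ∀ i ∈ I, ∀ j ∈ J,
        0 ≤ q i * q j * ((a j - A) * (b i - B) + (A - a i) * (b j - B)) := fun i hi j hj =>
      mul_nonneg (mul_nonneg (hqI i hi) (hqJ j hj)) (hpair i hi j hj).le
    have h1 := (Finset.sum_eq_zero_iff_of_nonneg fun i hi =>
      Finset.sum_nonneg (hnn i hi)).1 hdouble i hi
    have h2 := (Finset.sum_eq_zero_iff_of_nonneg (hnn i hi)).1 h1 j hj
    exact (mul_eq_zero.1 h2).resolve_right (hpair i hi j hj).ne'
  by_cases hall : ∀ j ∈ J, q j = 0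
  · have h1 : ∑ j ∈ J, q j * (b j - B) = 0 :=
      Finset.sum_eq_zero fun j hj => by rw [hall j hj, zero_mul]
    have h2 : ∑ i ∈ I, q i * (b i - B) = 0 := by linarith
    have h3 : ∑ i ∈ I, q i = 0 := Finset.sum_eq_zero fun i hi => by
      have := (Finset.sum_eq_zero_iff_of_nonneg fun i hi =>
        mul_nonneg (hqI i hi) (sub_pos.2 (hbI i hi)).le).1 h2 i hi
      exact (mul_eq_zero.1 this).resolve_right (sub_pos.2 (hbI i hi)).ne'
    have := hIJ q
    rw [h3, Finset.sum_eq_zero hall, hsum] at this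
    norm_num at this
  · push Not at hall
    obtain ⟨j, hj, hj0⟩ := hall
    have h1 : ∑ i ∈ I, q i * (A - a i) = 0 := Finset.sum_eq_zero fun i hi => by
      rw [(mul_eq_zero.1 (hzero i hi j hj)).resolve_right hj0, zero_mul]
    rw [hSa] at h1
    have := (Finset.sum_eq_zero_iff_of_nonneg fun j hj =>
      mul_nonneg (hqJ j hj) (sub_pos.2 (hJ j hj).2).le).1 h1 j hj
    exact hj0 ((mul_eq_zero.1 this).resolve_right (sub_pos.2 (hJ j hj).2).ne')

end Deterministic

section Measurability

variable {n : ℕ}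

lemma measurableSet_sort_eq (σ : Equiv.Perm (Fin n)) :
    MeasurableSet {w : Fin n → ℝ | Tuple.sort w = σ} := by
  have h : {w : Fin n → ℝ | Tuple.sort w = σ}
      = (⋂ i, ⋂ j, {w : Fin n → ℝ | i ≤ j → w (σ i) ≤ w (σ j)}) ∩
        ⋂ i, ⋂ j, {w : Fin n → ℝ | i < j → w (σ i) = w (σ j) → σ i < σ j} := by
    ext w
    simp only [Set.mem_ofPred_eq, Set.mem_inter_iff, Set.mem_iInter]
    rw [eq_comm, Tuple.eq_sort_iff]
    rfl
  rw [h]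
  refine .inter (.iInter fun i => .iInter fun j => ?_) (.iInter fun i => .iInter fun j => ?_)
  · exact (MeasurableSet.const _).imp (measurableSet_le (by fun_prop) (by fun_prop))
  · exact (MeasurableSet.const _).imp
      ((measurableSet_eq_fun (by fun_prop) (by fun_prop)).imp (.const _))

lemma measurable_of_sort {β : Type*} [MeasurableSpace β]
    (g : Equiv.Perm (Fin n) → (Fin n → ℝ) → β) (hg : ∀ σ, Measurable (g σ)) :
    Measurable fun w : Fin n → ℝ => g (Tuple.sort w) w := by
  let _ : MeasurableSpace (Equiv.Perm (Fin n)) := ⊤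
  have hs : Measurable fun w : Fin n → ℝ => Tuple.sort w :=
    measurable_to_countable' fun σ => measurableSet_sort_eq σ
  have hg' : Measurable fun p : (Fin n → ℝ) × Equiv.Perm (Fin n) => g p.2 p.1 :=
    measurable_from_prod_countable_left hg
  exact hg'.comp (measurable_id.prodMk hs)

lemma measurable_sortedVal (i : ℕ) : Measurable fun w : Fin n → ℝ => sortedVal n w i := by
  simp_rw [sortedVal_eq]
  split_ifs with h
  · exact measurable_of_sort (fun σ w => w (σ ⟨i - 1, h⟩)) fun σ => by fun_prop
  · fun_prop

lemma measurable_avgLow (k : ℕ) : Measurable fun w : Fin n → ℝ => avgLow n w k :=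
  (Finset.measurable_fun_sum _ fun i _ => measurable_sortedVal i).div_const _

lemma measurable_avgHigh (k : ℕ) : Measurable fun w : Fin n → ℝ => avgHigh n w k :=
  (Finset.measurable_fun_sum _ fun i _ => (measurable_sortedVal i).const_sub 1).div_const _

lemma measurable_rankRule (k : ℕ) : Measurable fun w : Fin n → ℝ => rankRule w k :=
  measurable_of_sort (fun σ _ i => decide (((σ.symm i : Fin n) : ℕ) < k))
    fun _ => measurable_const

lemma measurable_lowLoss (d : Fin n → Bool) : Measurable fun w : Fin n → ℝ => lowLoss w d := by
  refine (Finset.measurable_fun_sum _ fun i _ => ?_).div_const _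
  split_ifs <;> fun_prop

lemma measurable_highLoss (d : Fin n → Bool) : Measurable fun w : Fin n → ℝ => highLoss w d := by
  refine (Finset.measurable_fun_sum _ fun i _ => ?_).div_const _
  split_ifs <;> fun_prop

end Measurability

namespace Model

variable {𝒳 : Type*} [MeasurableSpace 𝒳] (M : Model 𝒳)

lemma π1_pos : 0 < M.π1 := sub_pos.2 M.π0_mem.2

lemma f_nonneg (x : 𝒳) : 0 ≤ M.f x :=
  add_nonneg (mul_nonneg M.π0_mem.1.le (M.f0_nonneg x)) (mul_nonneg M.π1_pos.le (M.f1_nonneg x))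

lemma measurable_Lfdr : Measurable M.Lfdr :=
  (M.f0_meas.const_mul _).div ((M.f0_meas.const_mul _).add (M.f1_meas.const_mul _))

lemma Lfdr_mem (x : 𝒳) : M.Lfdr x ∈ Set.Icc (0 : ℝ) 1 :=
  ⟨div_nonneg (mul_nonneg M.π0_mem.1.le (M.f0_nonneg x)) (M.f_nonneg x),
    div_le_one_of_le₀ (le_add_of_nonneg_right (mul_nonneg M.π1_pos.le (M.f1_nonneg x)))
      (M.f_nonneg x)⟩

lemma Lfdr_mul_f (x : 𝒳) : M.Lfdr x * M.f x = M.π0 * M.f0 x := by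
  rcases eq_or_ne (M.f x) 0 with h | h
  · have h0 : 0 ≤ M.π0 * M.f0 x := mul_nonneg M.π0_mem.1.le (M.f0_nonneg x)
    have h1 : 0 ≤ M.π1 * M.f1 x := mul_nonneg M.π1_pos.le (M.f1_nonneg x)
    have h2 : M.π0 * M.f0 x + M.π1 * M.f1 x = 0 := h
    rw [h, mul_zero]
    linarith
  · exact div_mul_cancel₀ _ h

instance : IsProbabilityMeasure M.joint := by
  have := M.f0_prob
  have := M.f1_prob
  constructor
  simp only [joint, Measure.add_apply, Measure.smul_apply, measure_univ, smul_eq_mul, mul_one]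
  rw [← ENNReal.ofReal_add M.π0_mem.1.le M.π1_pos.le]
  simp [π1]

instance (n : ℕ) : IsProbabilityMeasure (M.jointN n) := by
  unfold jointN
  infer_instance

lemma lintegral_joint {φ : Bool × 𝒳 → ENNReal} (hφ : Measurable φ) :
    ∫⁻ p, φ p ∂M.joint = ENNReal.ofReal M.π0 * ∫⁻ x, ENNReal.ofReal (M.f0 x) * φ (false, x) ∂M.base
      + ENNReal.ofReal M.π1 * ∫⁻ x, ENNReal.ofReal (M.f1 x) * φ (true, x) ∂M.base := by
  have := M.sigmaFinite
  have := M.f0_prob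
  have := M.f1_prob
  have h0 := M.f0_meas
  have h1 := M.f1_meas
  rw [joint, lintegral_add_measure, lintegral_smul_measure, lintegral_smul_measure,
    lintegral_prod _ hφ.aemeasurable, lintegral_prod _ hφ.aemeasurable, lintegral_dirac,
    lintegral_dirac,
    lintegral_withDensity_eq_lintegral_mul _ (by fun_prop) (by fun_prop),
    lintegral_withDensity_eq_lintegral_mul _ (by fun_prop) (by fun_prop)]
  rfl

lemma lintegral_joint_null {φ : 𝒳 → ENNReal} (hφ : Measurable φ) :
    ∫⁻ p, φ p.2 * ENNReal.ofReal (if p.1 then 0 else 1) ∂M.joint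
      = ∫⁻ p, φ p.2 * ENNReal.ofReal (M.Lfdr p.2) ∂M.joint := by
  have h0 := M.f0_meas
  have h1 := M.f1_meas
  have hL := M.measurable_Lfdr
  have hθ : Measurable fun p : Bool × 𝒳 => ENNReal.ofReal (if p.1 then 0 else 1) :=
    (Measurable.of_discrete (f := fun b : Bool => ENNReal.ofReal (if b then 0 else 1))).comp
      measurable_fst
  rw [M.lintegral_joint (by fun_prop), M.lintegral_joint (by fun_prop)]
  simp only [Bool.false_eq_true, if_false, if_true, ENNReal.ofReal_one, ENNReal.ofReal_zero,
    mul_one, mul_zero, lintegral_zero, add_zero]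
  rw [← lintegral_const_mul _ (by fun_prop), ← lintegral_const_mul _ (by fun_prop),
    ← lintegral_const_mul _ (by fun_prop), ← lintegral_add_left (by fun_prop)]
  refine lintegral_congr fun x => ?_
  have h : ENNReal.ofReal (M.Lfdr x) * (ENNReal.ofReal M.π0 * ENNReal.ofReal (M.f0 x)
      + ENNReal.ofReal M.π1 * ENNReal.ofReal (M.f1 x))
      = ENNReal.ofReal M.π0 * ENNReal.ofReal (M.f0 x) := by
    rw [← ENNReal.ofReal_mul M.π0_mem.1.le, ← ENNReal.ofReal_mul M.π1_pos.le,
      ← ENNReal.ofReal_add (mul_nonneg M.π0_mem.1.le (M.f0_nonneg x))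
        (mul_nonneg M.π1_pos.le (M.f1_nonneg x)), ← ENNReal.ofReal_mul (M.Lfdr_mem x).1]
    exact congrArg ENNReal.ofReal (M.Lfdr_mul_f x)
  calc _ = φ x * (ENNReal.ofReal M.π0 * ENNReal.ofReal (M.f0 x)) := by ring
    _ = _ := by rw [← h]; ring

variable {n : ℕ}

lemma measurable_obs : Measurable fun (ω : Fin n → Bool × 𝒳) i => (ω i).2 := by
  fun_prop

lemma measurable_label (i : Fin n) :
    Measurable fun ω : Fin n → Bool × 𝒳 => if (ω i).1 then (0 : ℝ) else 1 :=
  (Measurable.of_discrete (f := fun b : Bool => if b then (0 : ℝ) else 1)).comp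
    (measurable_fst.comp (measurable_pi_apply i))

/-- Conditionally on the observations, the `i`-th label is null with probability
`Lfdr (X i)`. -/
lemma integral_label_eq_integral_Lfdr {h : (Fin n → 𝒳) → ℝ} (hm : Measurable h)
    (h0 : ∀ x, 0 ≤ h x) (i : Fin n) :
    ∫ ω, h (fun j => (ω j).2) * (if (ω i).1 then (0 : ℝ) else 1) ∂M.jointN n
      = ∫ ω, h (fun j => (ω j).2) * M.Lfdr (ω i).2 ∂M.jointN n := by
  have hL := M.measurable_Lfdr
  have hl := measurable_label (𝒳 := 𝒳) i
  have hh : Measurable fun ω : Fin n → Bool × 𝒳 => h fun j => (ω j).2 := hm.comp measurable_obs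
  rw [integral_eq_lintegral_of_nonneg_ae
      (.of_forall fun ω => mul_nonneg (h0 _) (by split_ifs <;> norm_num))
      (by fun_prop),
    integral_eq_lintegral_of_nonneg_ae (.of_forall fun ω => mul_nonneg (h0 _) (M.Lfdr_mem _).1)
      (by fun_prop)]
  congr 1
  refine lintegral_eq_of_lmarginal_eq {i} (by fun_prop) (by fun_prop) ?_
  rw [lmarginal_singleton, lmarginal_singleton]
  ext ω
  simp_rw [ENNReal.ofReal_mul (h0 _), Function.update_self]
  have hobs : ∀ p : Bool × 𝒳, (fun j => (Function.update ω i p j).2)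
      = Function.update (fun j => (ω j).2) i p.2 := fun p => by
    ext j
    rcases eq_or_ne j i with rfl | hj <;> simp [*]
  simp_rw [hobs]
  exact M.lintegral_joint_null
    (φ := fun y => ENNReal.ofReal (h (Function.update (fun j => (ω j).2) i y))) (by fun_prop)

end Model

lemma FDP_eq_sum {n : ℕ} (θ d : Fin n → Bool) :
    FDP θ d = 0 + ∑ i, (if d i then 1 else 0) / max 1 (nRej d) * (if θ i then (0 : ℝ) else 1) := by
  rw [FDP, nFD, Finset.sum_div, zero_add]
  exact Finset.sum_congr rfl fun i _ => by ring

lemma lowLoss_eq_sum {n : ℕ} (w : Fin n → ℝ) (d : Fin n → Bool) :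
    lowLoss w d = 0 + ∑ i, (if d i then 1 else 0) / max 1 (nRej d) * w i := by
  rw [lowLoss, Finset.sum_div, zero_add]
  exact Finset.sum_congr rfl fun i _ => by split_ifs <;> ring

lemma FNP_eq_sum {n : ℕ} (θ d : Fin n → Bool) :
    FNP θ d = ∑ i, (if d i then (0 : ℝ) else 1) / max 1 (nAcc d)
      + ∑ i, -((if d i then 0 else 1) / max 1 (nAcc d)) * (if θ i then (0 : ℝ) else 1) := by
  rw [FNP, nFN, Finset.sum_div, ← Finset.sum_add_distrib]
  exact Finset.sum_congr rfl fun i _ => by split_ifs <;> ring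

lemma highLoss_eq_sum {n : ℕ} (w : Fin n → ℝ) (d : Fin n → Bool) :
    highLoss w d = ∑ i, (if d i then (0 : ℝ) else 1) / max 1 (nAcc d)
      + ∑ i, -((if d i then 0 else 1) / max 1 (nAcc d)) * w i := by
  rw [highLoss, Finset.sum_div, ← Finset.sum_add_distrib]
  exact Finset.sum_congr rfl fun i _ => by split_ifs <;> ring

lemma FNP_nonneg {n : ℕ} (θ d : Fin n → Bool) : 0 ≤ FNP θ d :=
  div_nonneg (Finset.sum_nonneg fun i _ => by split_ifs <;> norm_num) (by positivity)

namespace Model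

variable {𝒳 : Type*} [MeasurableSpace 𝒳] (M : Model 𝒳) {n : ℕ}

lemma integral_rule_label_eq {κ : (Fin n → 𝒳) → Measure (Fin n → Bool)} (hκ : IsRule κ)
    (b : (Fin n → Bool) → ℝ) (c : (Fin n → Bool) → Fin n → ℝ) :
    ∫ ω, ∫ d, b d + ∑ i, c d i * (if (ω i).1 then (0 : ℝ) else 1) ∂(κ fun i => (ω i).2)
        ∂(M.jointN n)
      = ∫ ω, ∫ d, b d + ∑ i, c d i * M.Lfdr (ω i).2 ∂(κ fun i => (ω i).2) ∂(M.jointN n) := by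
  have hprob := hκ.2
  have hm : ∀ d, Measurable fun x => (κ x).real {d} := fun d =>
    ((Measure.measurable_coe (MeasurableSet.singleton d)).comp hκ.1).ennreal_toReal
  have hexp : ∀ (η : (Fin n → Bool × 𝒳) → Fin n → ℝ), (∀ i, Measurable fun ω => η ω i) →
      (∀ ω i, η ω i ∈ Set.Icc (0 : ℝ) 1) →
      ∫ ω, ∫ d, b d + ∑ i, c d i * η ω i ∂(κ fun i => (ω i).2) ∂(M.jointN n)
      = ∑ d, (∫ ω, (κ fun j => (ω j).2).real {d} * b d ∂(M.jointN n)
        + ∑ i, c d i * ∫ ω, (κ fun j => (ω j).2).real {d} * η ω i ∂(M.jointN n)) := by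
    intro η hη hη1
    have hmo : ∀ d, Measurable fun ω : Fin n → Bool × 𝒳 => (κ fun j => (ω j).2).real {d} :=
      fun d => (hm d).comp measurable_obs
    have hint : ∀ d, Integrable (fun ω => (κ fun j => (ω j).2).real {d}) (M.jointN n) := fun d =>
      .of_bound (hmo d).aestronglyMeasurable 1 (.of_forall fun ω => by
        rw [Real.norm_of_nonneg measureReal_nonneg]
        exact measureReal_le_one)
    have hint2 : ∀ d i, Integrable (fun ω => (κ fun j => (ω j).2).real {d} * η ω i)
        (M.jointN n) := fun d i =>
      (hint d).mul_bdd (hη i).aestronglyMeasurable (c := 1) (.of_forall fun ω => by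
        rw [Real.norm_of_nonneg (hη1 ω i).1]
        exact (hη1 ω i).2)
    have hin : ∀ ω : Fin n → Bool × 𝒳,
        ∫ d, b d + ∑ i, c d i * η ω i ∂(κ fun i => (ω i).2)
        = ∑ d, ((κ fun j => (ω j).2).real {d} * b d
          + ∑ i, c d i * ((κ fun j => (ω j).2).real {d} * η ω i)) := fun ω => by
      rw [integral_fintype .of_finite]
      refine Finset.sum_congr rfl fun d _ => ?_
      rw [smul_eq_mul, mul_add, Finset.mul_sum]
      exact congrArg _ (Finset.sum_congr rfl fun i _ => by ring)
    simp_rw [hin]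
    have hint3 : ∀ d, Integrable
        (fun ω => ∑ i, c d i * ((κ fun j => (ω j).2).real {d} * η ω i)) (M.jointN n) := fun d =>
      integrable_finsetSum _ fun i _ => (hint2 d i).const_mul _
    refine (integral_finsetSum _ fun d _ => ((hint d).mul_const _).add (hint3 d)).trans ?_
    refine Finset.sum_congr rfl fun d _ => ?_
    refine (integral_add ((hint d).mul_const _) (hint3 d)).trans ?_
    rw [integral_finsetSum _ fun i _ => (hint2 d i).const_mul _]
    simp_rw [integral_const_mul]
  rw [hexp _ measurable_label fun ω i => by split_ifs <;> simp,
    hexp (fun ω i => M.Lfdr (ω i).2)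
      (fun i => M.measurable_Lfdr.comp (measurable_snd.comp (measurable_pi_apply i)))
      fun ω i => M.Lfdr_mem _]
  refine Finset.sum_congr rfl fun d _ => congrArg _ (Finset.sum_congr rfl fun i _ => ?_)
  rw [M.integral_label_eq_integral_Lfdr (hm d) (fun _ => measureReal_nonneg) i]

lemma FDR_eq {κ : (Fin n → 𝒳) → Measure (Fin n → Bool)} (hκ : IsRule κ) :
    M.FDR n κ = ∫ ω, ∫ d, lowLoss (fun j => M.Lfdr (ω j).2) d ∂(κ fun i => (ω i).2)
      ∂(M.jointN n) := by
  simp_rw [FDR, FDP_eq_sum, lowLoss_eq_sum]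
  exact M.integral_rule_label_eq hκ _ _

lemma FNR_eq {κ : (Fin n → 𝒳) → Measure (Fin n → Bool)} (hκ : IsRule κ) :
    M.FNR n κ = ∫ ω, ∫ d, highLoss (fun j => M.Lfdr (ω j).2) d ∂(κ fun i => (ω i).2)
      ∂(M.jointN n) := by
  simp_rw [FNR, FNP_eq_sum, highLoss_eq_sum]
  exact M.integral_rule_label_eq hκ _ _

lemma FNR_nonneg (κ : (Fin n → 𝒳) → Measure (Fin n → Bool)) : 0 ≤ M.FNR n κ :=
  integral_nonneg fun _ => integral_nonneg fun _ => FNP_nonneg _ _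

lemma measurable_integral_kernel {X β : Type*} [MeasurableSpace X] [MeasurableSpace β]
    [Countable β] [MeasurableSingletonClass β] {K : X → Measure β} (hK : Measurable K)
    (hP : ∀ x, IsProbabilityMeasure (K x)) {g : X → β → ℝ} (hg : ∀ k, Measurable fun x => g x k) :
    Measurable fun x => ∫ k, g x k ∂K x := by
  let κ : Kernel X β := ⟨K, hK⟩
  have : IsMarkovKernel κ := ⟨hP⟩
  have hg' : Measurable (Function.uncurry g) := measurable_from_prod_countable_left hg
  exact (hg'.stronglyMeasurable.integral_kernel_prod_right (κ := κ)).measurable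

lemma integrable_integral_kernel {β : Type*} [MeasurableSpace β]
    [Countable β] [MeasurableSingletonClass β] {K : (Fin n → 𝒳) → Measure β} (hK : Measurable K)
    (hP : ∀ x, IsProbabilityMeasure (K x)) {g : (Fin n → 𝒳) → β → ℝ}
    (hg : ∀ k, Measurable fun x => g x k)
    (hb : ∀ x, ∀ᵐ k ∂K x, g x k ∈ Set.Icc (0 : ℝ) 1) :
    Integrable (fun ω => ∫ k, g (fun i => (ω i).2) k ∂(K fun i => (ω i).2)) (M.jointN n) := by
  refine .of_bound ((measurable_integral_kernel hK hP hg).comp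
    measurable_obs).aestronglyMeasurable 1 (.of_forall fun ω => ?_)
  have := hP fun i => (ω i).2
  have h := norm_integral_le_of_norm_le_const (μ := K fun i => (ω i).2) (C := 1)
    (f := g fun i => (ω i).2) ((hb _).mono fun k hk => by
      rw [Real.norm_of_nonneg hk.1]
      exact hk.2)
  simpa using h

lemma ae_le_of_measure_eq_zero {μ : Measure ℕ} (h : μ {k | n < k} = 0) : ∀ᵐ k ∂μ, k ≤ n := by
  rw [ae_iff]
  simpa using h

lemma avgLow_mem (x : Fin n → 𝒳) {k : ℕ} (hk : k ≤ n) :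
    avgLow n (fun j => M.Lfdr (x j)) k ∈ Set.Icc (0 : ℝ) 1 := by
  rw [avgLow_eq_lowLoss _ hk]
  exact lowLoss_mem (fun _ => M.Lfdr_mem _) _

lemma avgHigh_mem (x : Fin n → 𝒳) {k : ℕ} (hk : k ≤ n) :
    avgHigh n (fun j => M.Lfdr (x j)) k ∈ Set.Icc (0 : ℝ) 1 := by
  rw [avgHigh_eq_highLoss _ hk]
  exact highLoss_mem (fun _ => M.Lfdr_mem _) _

lemma measurable_Lfdr_comp : Measurable fun (x : Fin n → 𝒳) j => M.Lfdr (x j) :=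
  measurable_pi_lambda _ fun j => M.measurable_Lfdr.comp (measurable_pi_apply j)

/-- Every rule is dominated by the ranked rule with the same number of rejections. -/
lemma exists_ranked_le (hn : 0 < n) {κ : (Fin n → 𝒳) → Measure (Fin n → Bool)}
    (hκ : IsRule κ) :
    ∃ K : (Fin n → 𝒳) → Measure ℕ, Measurable K ∧ (∀ x, IsProbabilityMeasure (K x)) ∧
      (∀ x, K x {k | n < k} = 0) ∧
      (∫ ω, ∫ k, avgLow n (fun j => M.Lfdr (ω j).2) k ∂(K fun i => (ω i).2)
        ∂(M.jointN n)) ≤ M.FDR n κ ∧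
      (∫ ω, ∫ k, avgHigh n (fun j => M.Lfdr (ω j).2) k ∂(K fun i => (ω i).2)
        ∂(M.jointN n)) ≤ M.FNR n κ := by
  have hprob := hκ.2
  have hrej : Measurable (rejCount (n := n)) := .of_discrete
  have hW := M.measurable_Lfdr_comp (n := n)
  have hmap : ∀ (x : Fin n → 𝒳) (g : ℕ → ℝ),
      ∫ k, g k ∂((κ x).map rejCount) = ∫ d, g (rejCount d) ∂κ x := fun x g =>
    integral_map hrej.aemeasurable Measurable.of_discrete.aestronglyMeasurable
  refine ⟨fun x => (κ x).map rejCount, (Measure.measurable_map _ hrej).comp hκ.1,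
    fun x => Measure.isProbabilityMeasure_map hrej.aemeasurable, fun x => ?_, ?_, ?_⟩
  · rw [Measure.map_apply hrej .of_discrete]
    convert measure_empty (μ := κ x)
    ext d
    simpa using rejCount_le d
  · simp_rw [M.FDR_eq hκ, hmap]
    refine integral_mono
      (M.integrable_integral_kernel hκ.1 hκ.2
        (g := fun x d => avgLow n (fun j => M.Lfdr (x j)) (rejCount d))
        (fun d => (measurable_avgLow _).comp hW)
        fun x => .of_forall fun d => M.avgLow_mem x (rejCount_le d))
      (M.integrable_integral_kernel hκ.1 hκ.2
        (g := fun x d => lowLoss (fun j => M.Lfdr (x j)) d)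
        (fun d => (measurable_lowLoss _).comp hW)
        fun x => .of_forall fun d => lowLoss_mem (fun _ => M.Lfdr_mem _) d)
      fun ω => integral_mono .of_finite .of_finite fun d => avgLow_rejCount_le hn _ d
  · simp_rw [M.FNR_eq hκ, hmap]
    refine integral_mono
      (M.integrable_integral_kernel hκ.1 hκ.2
        (g := fun x d => avgHigh n (fun j => M.Lfdr (x j)) (rejCount d))
        (fun d => (measurable_avgHigh _).comp hW)
        fun x => .of_forall fun d => M.avgHigh_mem x (rejCount_le d))
      (M.integrable_integral_kernel hκ.1 hκ.2
        (g := fun x d => highLoss (fun j => M.Lfdr (x j)) d)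
        (fun d => (measurable_highLoss _).comp hW)
        fun x => .of_forall fun d => highLoss_mem (fun _ => M.Lfdr_mem _) d)
      fun ω => integral_mono .of_finite .of_finite fun d => avgHigh_rejCount_le hn _ d

/-- Rejecting the `K` smallest local false discovery rates is a decision rule. -/
lemma exists_rule_eq {K : (Fin n → 𝒳) → Measure ℕ} (hK : Measurable K)
    (hP : ∀ x, IsProbabilityMeasure (K x)) (hKn : ∀ x, K x {k | n < k} = 0) :
    ∃ κ : (Fin n → 𝒳) → Measure (Fin n → Bool), IsRule κ ∧
      M.FDR n κ = ∫ ω, ∫ k, avgLow n (fun j => M.Lfdr (ω j).2) k ∂(K fun i => (ω i).2)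
        ∂(M.jointN n) ∧
      M.FNR n κ = ∫ ω, ∫ k, avgHigh n (fun j => M.Lfdr (ω j).2) k ∂(K fun i => (ω i).2)
        ∂(M.jointN n) := by
  let rule : (Fin n → 𝒳) → ℕ → Fin n → Bool := fun x => rankRule fun j => M.Lfdr (x j)
  have hrule : Measurable (Function.uncurry rule) :=
    measurable_from_prod_countable_left fun k =>
      (measurable_rankRule k).comp M.measurable_Lfdr_comp
  let KK : Kernel (Fin n → 𝒳) ℕ := ⟨K, hK⟩
  have : IsMarkovKernel KK := ⟨hP⟩
  let κ : Kernel (Fin n → 𝒳) (Fin n → Bool) := (Kernel.id ×ₖ KK).map (Function.uncurry rule)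
  have hκ : ∀ x, κ x = (K x).map (rule x) := fun x => by
    rw [Kernel.map_apply _ hrule, Kernel.prod_apply, Kernel.id_apply, Measure.dirac_prod,
      Measure.map_map hrule measurable_prodMk_left]
    rfl
  have hisRule : IsRule (fun x => (K x).map (rule x)) := by
    refine ⟨?_, fun x => Measure.isProbabilityMeasure_map Measurable.of_discrete.aemeasurable⟩
    rw [← funext hκ]
    exact κ.measurable
  refine ⟨_, hisRule, ?_, ?_⟩
  · rw [M.FDR_eq hisRule]
    refine integral_congr_ae (.of_forall fun ω => ?_)
    beta_reduce
    rw [integral_map Measurable.of_discrete.aemeasurable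
      Measurable.of_discrete.aestronglyMeasurable]
    refine integral_congr_ae ((ae_le_of_measure_eq_zero (hKn _)).mono fun k hk => ?_)
    exact (avgLow_eq_lowLoss _ hk).symm
  · rw [M.FNR_eq hisRule]
    refine integral_congr_ae (.of_forall fun ω => ?_)
    beta_reduce
    rw [integral_map Measurable.of_discrete.aemeasurable
      Measurable.of_discrete.aestronglyMeasurable]
    refine integral_congr_ae ((ae_le_of_measure_eq_zero (hKn _)).mono fun k hk => ?_)
    exact (avgHigh_eq_highLoss _ hk).symm

end Model

lemma integral_nat_eq_sum {n : ℕ} {μ : Measure ℕ} [IsFiniteMeasure μ]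
    (h : μ {k | n < k} = 0) (g : ℕ → ℝ) :
    ∫ k, g k ∂μ = ∑ k ∈ Finset.range (n + 1), μ.real {k} * g k := by
  have hr : μ.restrict (Finset.range (n + 1) : Set ℕ) = μ :=
    Measure.restrict_eq_self_of_ae_mem
      ((Model.ae_le_of_measure_eq_zero h).mono fun k hk => by simpa using Nat.lt_succ_of_le hk)
  conv_lhs => rw [← hr]
  rw [setIntegral_finset _ IntegrableOn.finset]
  rfl

/-- Every kernel into `{0, …, n}` is dominated, for a pair of measurable losses, by a kernel
whose laws are supported on at most two points. -/
lemma exists_two_point_kernel_le {X : Type*} [MeasurableSpace X] {n : ℕ} {K : X → Measure ℕ}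
    (hK : Measurable K) (hP : ∀ x, IsProbabilityMeasure (K x)) (hKn : ∀ x, K x {k | n < k} = 0)
    {a b : X → ℕ → ℝ} (ha : ∀ k, Measurable fun x => a x k) (hb : ∀ k, Measurable fun x => b x k) :
    ∃ K' : X → Measure ℕ, Measurable K' ∧ (∀ x, IsProbabilityMeasure (K' x)) ∧
      (∀ x, K' x {k | n < k} = 0) ∧ (∀ x, ∃ k1 k2 : ℕ, K' x ({k1, k2} : Set ℕ)ᶜ = 0) ∧
      (∀ x, ∫ k, a x k ∂K' x ≤ ∫ k, a x k ∂K x) ∧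
      ∀ x, ∫ k, b x k ∂K' x ≤ ∫ k, b x k ∂K x := by
  classical
  let A : X → ℝ := fun x => ∫ k, a x k ∂K x
  let B : X → ℝ := fun x => ∫ k, b x k ∂K x
  have hA : Measurable A := Model.measurable_integral_kernel hK hP ha
  have hB : Measurable B := Model.measurable_integral_kernel hK hP hb
  let t : X → ℕ → ℝ := fun x m =>
    (a x m.unpair.2 - A x) / (a x m.unpair.2 - a x m.unpair.1)
  have ht : ∀ m, Measurable fun x => t x m := fun m =>
    ((ha _).sub hA).div ((ha _).sub (ha _))
  let p : X → ℕ → Prop := fun x m => (m.unpair.1 ≤ n ∧ m.unpair.2 ≤ n) ∧ 0 ≤ t x m ∧ t x m ≤ 1 ∧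
    t x m * a x m.unpair.1 + (1 - t x m) * a x m.unpair.2 ≤ A x ∧
    t x m * b x m.unpair.1 + (1 - t x m) * b x m.unpair.2 ≤ B x
  have hp : ∀ x, ∃ m, p x m := fun x => by
    have := hP x
    obtain ⟨i, hi, j, hj, h⟩ := exists_two_point_le (Finset.range (n + 1))
      (fun k => (K x).real {k}) (a x) (b x) (fun _ _ => measureReal_nonneg)
      (by simpa using (integral_nat_eq_sum (hKn x) fun _ => 1).symm)
      (integral_nat_eq_sum (hKn x) (a x)) (integral_nat_eq_sum (hKn x) (b x))
    refine ⟨Nat.pair i j, ?_⟩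
    simp only [p, t, Nat.unpair_pair]
    exact ⟨⟨Nat.le_of_lt_succ (Finset.mem_range.1 hi), Nat.le_of_lt_succ (Finset.mem_range.1 hj)⟩,
      h⟩
  have hpm : ∀ m, MeasurableSet {x | p x m} := fun m => by
    have hmix : ∀ {g : X → ℕ → ℝ}, (∀ k, Measurable fun x => g x k) →
        Measurable fun x => t x m * g x m.unpair.1 + (1 - t x m) * g x m.unpair.2 := fun hg =>
      ((ht m).mul (hg _)).add (((ht m).const_sub 1).mul (hg _))
    exact (MeasurableSet.const _).inter ((measurableSet_le measurable_const (ht m)).inter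
      ((measurableSet_le (ht m) measurable_const).inter
        ((measurableSet_le (hmix ha) hA).inter (measurableSet_le (hmix hb) hB))))
  let N : X → ℕ := fun x => Nat.find (hp x)
  have hN : Measurable N := measurable_find hp hpm
  have hNp : ∀ x, p x (N x) := fun x => Nat.find_spec (hp x)
  have htN : Measurable fun x => t x (N x) :=
    (measurable_from_prod_countable_left (f := fun q : X × ℕ => t q.1 q.2) ht).comp
      (measurable_id.prodMk hN)
  let K' : X → Measure ℕ := fun x =>
    ENNReal.ofReal (t x (N x)) • Measure.dirac (N x).unpair.1
      + ENNReal.ofReal (1 - t x (N x)) • Measure.dirac (N x).unpair.2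
  have hint : ∀ x (g : ℕ → ℝ), ∫ k, g k ∂K' x
      = t x (N x) * g (N x).unpair.1 + (1 - t x (N x)) * g (N x).unpair.2 := fun x g => by
    have hd : ∀ m : ℕ, Integrable g (Measure.dirac m) := fun m => integrable_dirac (by simp)
    rw [integral_add_measure ((hd _).smul_measure ENNReal.ofReal_ne_top)
      ((hd _).smul_measure ENNReal.ofReal_ne_top), integral_smul_measure, integral_smul_measure,
      integral_dirac, integral_dirac, ENNReal.toReal_ofReal (hNp x).2.1,
      ENNReal.toReal_ofReal (sub_nonneg.2 (hNp x).2.2.1), smul_eq_mul, smul_eq_mul]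
  refine ⟨K', ?_, fun x => ⟨?_⟩, fun x => ?_, fun x => ⟨(N x).unpair.1, (N x).unpair.2, ?_⟩,
    fun x => ?_, fun x => ?_⟩
  · refine Measure.measurable_of_measurable_coe _ fun s hs => ?_
    have h1 : Measurable fun x => Measure.dirac (N x).unpair.1 s :=
      (Measurable.of_discrete (f := fun m : ℕ => Measure.dirac m.unpair.1 s)).comp hN
    have h2 : Measurable fun x => Measure.dirac (N x).unpair.2 s :=
      (Measurable.of_discrete (f := fun m : ℕ => Measure.dirac m.unpair.2 s)).comp hN
    simp only [K', Measure.add_apply, Measure.smul_apply, smul_eq_mul]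
    exact (htN.ennreal_ofReal.mul h1).add ((htN.const_sub 1).ennreal_ofReal.mul h2)
  · simp only [K', Measure.add_apply, Measure.smul_apply, measure_univ, smul_eq_mul, mul_one]
    rw [← ENNReal.ofReal_add (hNp x).2.1 (sub_nonneg.2 (hNp x).2.2.1)]
    simp
  · have h := (hNp x).1
    simp [K', h.1, h.2]
  · simp [K']
  · rw [hint]
    exact (hNp x).2.2.2.1
  · rw [hint]
    exact (hNp x).2.2.2.2

/-- **Reduction to ranked-rejection rules** (Lemma 3). `FNR*_n(α)` equals the infimum of
`E[(1/(n-K)) Σ_{i=K+1}^n (1-W_(i))]` over Markov kernels `K` from `𝒳^n` to `{0,1,…,n}`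
subject to `E[(1/K) Σ_{i=1}^K W_(i)] ≤ α`, and moreover the infimum is unchanged when
restricting to kernels whose conditional law given `X^n = x^n` is supported on at most two
values of `K`. -/
theorem FNRstar_eq_ranked_inf {𝒳 : Type*} [MeasurableSpace 𝒳] (M : Model 𝒳)
    (n : ℕ) (hn : 0 < n) (α : ℝ) (hα : α ∈ Set.Icc (0 : ℝ) 1) :
    M.FNRstar n α =
      sInf {r | ∃ K : (Fin n → 𝒳) → Measure ℕ,
        Measurable K ∧ (∀ x, IsProbabilityMeasure (K x)) ∧ (∀ x, K x {k | n < k} = 0) ∧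
        (∫ ω, ∫ k, avgLow n (fun j => M.Lfdr (ω j).2) k ∂(K fun i => (ω i).2)
            ∂(M.jointN n)) ≤ α ∧
        r = ∫ ω, ∫ k, avgHigh n (fun j => M.Lfdr (ω j).2) k ∂(K fun i => (ω i).2)
            ∂(M.jointN n)} ∧
    M.FNRstar n α =
      sInf {r | ∃ K : (Fin n → 𝒳) → Measure ℕ,
        Measurable K ∧ (∀ x, IsProbabilityMeasure (K x)) ∧ (∀ x, K x {k | n < k} = 0) ∧
        (∀ x, ∃ k1 k2 : ℕ, K x ({k1, k2} : Set ℕ)ᶜ = 0) ∧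
        (∫ ω, ∫ k, avgLow n (fun j => M.Lfdr (ω j).2) k ∂(K fun i => (ω i).2)
            ∂(M.jointN n)) ≤ α ∧
        r = ∫ ω, ∫ k, avgHigh n (fun j => M.Lfdr (ω j).2) k ∂(K fun i => (ω i).2)
            ∂(M.jointN n)} := by
  set A : Set ℝ := {r | ∃ κ : (Fin n → 𝒳) → Measure (Fin n → Bool),
    IsRule κ ∧ M.FDR n κ ≤ α ∧ r = M.FNR n κ}
  have hstar : M.FNRstar n α = sInf A := rfl
  rw [hstar]
  generalize hB : {r | ∃ K : (Fin n → 𝒳) → Measure ℕ,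
        Measurable K ∧ (∀ x, IsProbabilityMeasure (K x)) ∧ (∀ x, K x {k | n < k} = 0) ∧
        (∫ ω, ∫ k, avgLow n (fun j => M.Lfdr (ω j).2) k ∂(K fun i => (ω i).2)
            ∂(M.jointN n)) ≤ α ∧
        r = ∫ ω, ∫ k, avgHigh n (fun j => M.Lfdr (ω j).2) k ∂(K fun i => (ω i).2)
            ∂(M.jointN n)} = B
  generalize hC : {r | ∃ K : (Fin n → 𝒳) → Measure ℕ,
        Measurable K ∧ (∀ x, IsProbabilityMeasure (K x)) ∧ (∀ x, K x {k | n < k} = 0) ∧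
        (∀ x, ∃ k1 k2 : ℕ, K x ({k1, k2} : Set ℕ)ᶜ = 0) ∧
        (∫ ω, ∫ k, avgLow n (fun j => M.Lfdr (ω j).2) k ∂(K fun i => (ω i).2)
            ∂(M.jointN n)) ≤ α ∧
        r = ∫ ω, ∫ k, avgHigh n (fun j => M.Lfdr (ω j).2) k ∂(K fun i => (ω i).2)
            ∂(M.jointN n)} = C
  have hCB : C ⊆ B := by
    subst hB hC
    rintro r ⟨K, hK, hP, hKn, -, hlow, rfl⟩
    exact ⟨K, hK, hP, hKn, hlow, rfl⟩
  have hBA : B ⊆ A := by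
    subst hB
    rintro r ⟨K, hK, hP, hKn, hlow, rfl⟩
    obtain ⟨κ, hκ, hFDR, hFNR⟩ := M.exists_rule_eq hK hP hKn
    exact ⟨κ, hκ, hFDR.trans_le hlow, hFNR.symm⟩
  have hA0 : BddBelow A := ⟨0, by
    rintro r ⟨κ, -, -, rfl⟩
    exact M.FNR_nonneg κ⟩
  have hCne : C.Nonempty := by
    subst hC
    refine ⟨_, fun _ => Measure.dirac 0, measurable_const, fun _ => inferInstance,
      fun _ => by simp, fun _ => ⟨0, 0, by simp⟩, ?_, rfl⟩
    simpa [avgLow] using hα.1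
  have hCA : sInf C ≤ sInf A := by
    refine le_csInf (hCne.mono (hCB.trans hBA)) ?_
    rintro r ⟨κ, hκ, hFDR, rfl⟩
    obtain ⟨K, hK, hP, hKn, hlow, hhigh⟩ := M.exists_ranked_le hn hκ
    have ha : ∀ k, Measurable fun x : Fin n → 𝒳 => avgLow n (fun j => M.Lfdr (x j)) k :=
      fun k => (measurable_avgLow k).comp M.measurable_Lfdr_comp
    have hb : ∀ k, Measurable fun x : Fin n → 𝒳 => avgHigh n (fun j => M.Lfdr (x j)) k :=
      fun k => (measurable_avgHigh k).comp M.measurable_Lfdr_comp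
    obtain ⟨K', hK', hP', hKn', htwo, hlow', hhigh'⟩ :=
      exists_two_point_kernel_le hK hP hKn ha hb
    have hintLow : ∀ {L : (Fin n → 𝒳) → Measure ℕ}, Measurable L →
        (∀ x, IsProbabilityMeasure (L x)) → (∀ x, L x {k | n < k} = 0) →
        Integrable (fun ω : Fin n → Bool × 𝒳 =>
          ∫ k, avgLow n (fun j => M.Lfdr (ω j).2) k ∂(L fun i => (ω i).2)) (M.jointN n) :=
      fun hL hLP hLn => M.integrable_integral_kernel hL hLP ha fun x =>
        (Model.ae_le_of_measure_eq_zero (hLn x)).mono fun k hk => M.avgLow_mem x hk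
    have hintHigh : ∀ {L : (Fin n → 𝒳) → Measure ℕ}, Measurable L →
        (∀ x, IsProbabilityMeasure (L x)) → (∀ x, L x {k | n < k} = 0) →
        Integrable (fun ω : Fin n → Bool × 𝒳 =>
          ∫ k, avgHigh n (fun j => M.Lfdr (ω j).2) k ∂(L fun i => (ω i).2)) (M.jointN n) :=
      fun hL hLP hLn => M.integrable_integral_kernel hL hLP hb fun x =>
        (Model.ae_le_of_measure_eq_zero (hLn x)).mono fun k hk => M.avgHigh_mem x hk
    refine csInf_le_of_le (hA0.mono (hCB.trans hBA)) (b := ∫ ω, ∫ k,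
      avgHigh n (fun j => M.Lfdr (ω j).2) k ∂(K' fun i => (ω i).2) ∂(M.jointN n)) ?_ ?_
    · subst hC
      exact ⟨K', hK', hP', hKn', htwo,
        ((integral_mono (hintLow hK' hP' hKn') (hintLow hK hP hKn)
          fun ω => hlow' _).trans hlow).trans hFDR, rfl⟩
    · exact (integral_mono (hintHigh hK' hP' hKn') (hintHigh hK hP hKn)
        fun ω => hhigh' _).trans hhigh
  have hAB : sInf A ≤ sInf B := csInf_le_csInf hA0 (hCne.mono hCB) hBA
  have hBC : sInf B ≤ sInf C := csInf_le_csInf (hA0.mono hBA) hCne hCB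
  exact ⟨hAB.antisymm (hBC.trans hCA), (hAB.trans hBC).antisymm hCA⟩

end TwoGroup
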